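/- arXiv:1602.01262 — 6 statements merged into one kernel-verified Lean document; each statement's English description precedes it below -/
import Mathlib

section
/- Let Z = (Z₁, Z₂) be a random vector with values in ℝ₊², let α > 0, and let b : (0,∞) → (0,∞) be continuous, strictly increasing with b(t) → ∞ as t → ∞. Let ν be a Borel measure on ℝ₊² such that ν(cB) = c^{-α} ν(B) for all c > 0 and Borel B, ν is concentrated on the diagonal [diag] = {(x,x) : x ≥ 0} (i.e. ν(ℝ₊² \ [diag]) = 0), 0 < ν((1,∞)×[0,∞)) < ∞, and for every s > 0 one has t·P(Z₁ > b(t)s) → ν((s,∞)×[0,∞)) and t·P(Z₂ > b(t)s) → ν([0,∞)×(s,∞)) as t → ∞. Then lim_{t→∞} P(Z₁ > t)/P(Z₂ > t) = 1. -/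
open MeasureTheory ProbabilityTheory Filter Set Topology

/-- A continuous, strictly increasing function tending to infinity on `(0, ∞)` admits a right
inverse near infinity, which itself tends to infinity. -/
theorem exists_tendsto_atTop_rightInverse {b : ℝ → ℝ} (hcont : ContinuousOn b (Ioi 0))
    (hmono : StrictMonoOn b (Ioi 0)) (hinf : Tendsto b atTop atTop) :
    ∃ g : ℝ → ℝ, Tendsto g atTop atTop ∧ ∀ᶠ t in atTop, b (g t) = t := by
  have hex : ∀ t, b 1 ≤ t → ∃ u, 0 < u ∧ b u = t := by
    intro t ht
    obtain ⟨M, htM, hM⟩ := ((hinf.eventually_ge_atTop t).and (eventually_ge_atTop 1)).exists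
    obtain ⟨u, hu, hbu⟩ := intermediate_value_Icc hM
      (hcont.mono fun x hx => lt_of_lt_of_le one_pos hx.1) ⟨ht, htM⟩
    exact ⟨u, lt_of_lt_of_le one_pos hu.1, hbu⟩
  choose! g hgpos hg using hex
  refine ⟨g, tendsto_atTop.2 fun N => ?_, (eventually_ge_atTop (b 1)).mono hg⟩
  filter_upwards [eventually_ge_atTop (b 1), eventually_gt_atTop (b (max N 1))] with t h1 hN
  by_contra! hlt
  have hle : b (g t) ≤ b (max N 1) :=
    hmono.monotoneOn (hgpos t h1) (lt_of_lt_of_le one_pos (le_max_right N 1))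
      (hlt.le.trans (le_max_left N 1))
  rw [hg t h1] at hle
  exact absurd hN hle.not_gt

/-- A measure on the positive quadrant concentrated on the diagonal has equal marginal tails. -/
theorem measure_Ioi_prod_Ici_eq_of_diag {ν : Measure (ℝ × ℝ)}
    (hdiag : ν {p : ℝ × ℝ | (0 ≤ p.1 ∧ 0 ≤ p.2) ∧ p.1 ≠ p.2} = 0) {s : ℝ} (hs : 0 ≤ s) :
    ν (Ioi s ×ˢ Ici 0) = ν (Ici 0 ×ˢ Ioi s) := by
  refine measure_congr ?_
  have hae : ∀ᵐ p ∂ν, ¬((0 ≤ p.1 ∧ 0 ≤ p.2) ∧ p.1 ≠ p.2) := by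
    simpa only [ae_iff, not_not] using hdiag
  filter_upwards [hae] with p hp
  refine propext ?_
  change (s < p.1 ∧ 0 ≤ p.2) ↔ (0 ≤ p.1 ∧ s < p.2)
  grind

/-- If `Z = (Z₁, Z₂)` is a nonnegative random vector that is multivariate
regularly varying on `ℝ₊² \ {0}` with index `α`, scaling function `b` and limit measure `ν`
which is homogeneous of order `-α` and concentrates on the diagonal `[diag] = {(x,x) : x ≥ 0}`,
with `0 < ν((1,∞)×[0,∞)) < ∞`, then `P(Z₁ > t)/P(Z₂ > t) → 1` as `t → ∞`. -/
theorem full_asymptotic_dependence_tail_equivalence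
    {Ω : Type*} [MeasureSpace Ω] [IsProbabilityMeasure (ℙ : Measure Ω)]
    (Z₁ Z₂ : Ω → ℝ) (hZ₁ : Measurable Z₁) (hZ₂ : Measurable Z₂)
    (hZnonneg : ∀ ω, 0 ≤ Z₁ ω ∧ 0 ≤ Z₂ ω)
    (α : ℝ) (hα : 0 < α)
    (b : ℝ → ℝ) (hbpos : ∀ t > (0:ℝ), 0 < b t)
    (hbcont : ContinuousOn b (Ioi 0)) (hbmono : StrictMonoOn b (Ioi 0))
    (hbinf : Tendsto b atTop atTop)
    (ν : Measure (ℝ × ℝ))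
    -- ν is a (Borel) measure on ℝ₊² : no mass outside [0,∞)²
    (hνsupp : ν {p : ℝ × ℝ | ¬ (0 ≤ p.1 ∧ 0 ≤ p.2)} = 0)
    -- homogeneity: ν(cB) = c^(-α) ν(B)
    (hhom : ∀ c > (0:ℝ), ∀ B : Set (ℝ × ℝ), MeasurableSet B →
      ν ((fun p : ℝ × ℝ => (c * p.1, c * p.2)) '' B) = ENNReal.ofReal (c ^ (-α)) * ν B)
    -- ν concentrates on the diagonal: ν(ℝ₊² \ [diag]) = 0
    (hdiag : ν {p : ℝ × ℝ | (0 ≤ p.1 ∧ 0 ≤ p.2) ∧ p.1 ≠ p.2} = 0)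
    (hpos : 0 < ν (Ioi 1 ×ˢ Ici 0)) (hfin : ν (Ioi 1 ×ˢ Ici 0) < ⊤)
    -- marginal tail convergences of the regular variation
    (hconv1 : ∀ s > (0:ℝ), Tendsto (fun t : ℝ => t * (ℙ {ω | Z₁ ω > b t * s}).toReal)
      atTop (𝓝 (ν (Ioi s ×ˢ Ici 0)).toReal))
    (hconv2 : ∀ s > (0:ℝ), Tendsto (fun t : ℝ => t * (ℙ {ω | Z₂ ω > b t * s}).toReal)
      atTop (𝓝 (ν (Ici 0 ×ˢ Ioi s)).toReal)) :
    Tendsto (fun t : ℝ => (ℙ {ω | Z₁ ω > t}).toReal / (ℙ {ω | Z₂ ω > t}).toReal)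
      atTop (𝓝 1) := by
  have hν : ν (Ici 0 ×ˢ Ioi 1) = ν (Ioi 1 ×ˢ Ici 0) :=
    (measure_Ioi_prod_Ici_eq_of_diag hdiag zero_le_one).symm
  have hne : (ν (Ioi 1 ×ˢ Ici 0)).toReal ≠ 0 := (ENNReal.toReal_pos hpos.ne' hfin.ne).ne'
  obtain ⟨g, hg, hbg⟩ := exists_tendsto_atTop_rightInverse hbcont hbmono hbinf
  have h2 := hconv2 1 one_pos
  rw [hν] at h2
  have hlim := ((hconv1 1 one_pos).div h2 hne).comp hg
  rw [div_self hne] at hlim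
  refine hlim.congr' ?_
  filter_upwards [hbg, hg.eventually_gt_atTop 0] with t ht hpos
  simp only [Function.comp_apply, Pi.div_apply, ht, mul_one]
  exact mul_div_mul_left _ _ hpos.ne'
end

section
/- Let Z = (Z₁, Z₂) be a random vector with values in ℝ₊², let α > 0, let 0 < a_l ≤ a_u < ∞, and let b : (0,∞) → (0,∞) be continuous, strictly increasing with b(t) → ∞. Let ν be a Borel measure on ℝ₊² such that ν(cB) = c^{-α} ν(B) for all c > 0 and Borel B, ν is concentrated on [wedge] = {x ∈ ℝ₊² : a_l x₁ ≤ x₂ ≤ a_u x₁}, 0 < ν((1,∞)×[0,∞)) < ∞ and 0 < ν([0,∞)×(1,∞)) < ∞, and for every s > 0 one has t·P(Z₁ > b(t)s) → ν((s,∞)×[0,∞)) and t·P(Z₂ > b(t)s) → ν([0,∞)×(s,∞)) as t → ∞. If lim_{t→∞} P(Z₁ > t)/P(Z₂ > t) = 1, then a_l ≤ 1 ≤ a_u. -/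
open MeasureTheory ProbabilityTheory Filter Set Topology

/-- A finite positive quantity is strictly larger than its multiple by `c ^ (-α)`, for `c > 1`. -/
lemma ofReal_rpow_neg_mul_lt_self {c α : ℝ} (hc : 1 < c) (hα : 0 < α) {m : ENNReal}
    (hm0 : 0 < m) (hm : m < ⊤) : ENNReal.ofReal (c ^ (-α)) * m < m := by
  have hlt : ENNReal.ofReal (c ^ (-α)) < 1 :=
    ENNReal.ofReal_lt_one.2 (Real.rpow_lt_one_of_one_lt_of_neg hc (neg_lt_zero.2 hα))
  simpa using ENNReal.mul_lt_mul_left hm0.ne' hm.ne hlt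

/-- If the tails of `X` and `Y` are asymptotically equivalent, their normalised tails have the
same limit. -/
lemma tail_limits_eq {F G b : ℝ → ℝ} {x y : ℝ} (hb : Tendsto b atTop atTop)
    (hF : Tendsto (fun t => t * F (b t)) atTop (𝓝 x))
    (hG : Tendsto (fun t => t * G (b t)) atTop (𝓝 y)) (hy : y ≠ 0)
    (h : Tendsto (fun t => F t / G t) atTop (𝓝 1)) : x = y := by
  have h1 : Tendsto (fun t => F (b t) / G (b t)) atTop (𝓝 (x / y)) := by
    refine (hF.div hG hy).congr' ?_
    filter_upwards [eventually_gt_atTop 0] with t ht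
    exact mul_div_mul_left _ _ ht.ne'
  exact (div_eq_one_iff_eq hy).1 (tendsto_nhds_unique h1 (h.comp hb))

/-- If `Z = (Z₁, Z₂)` is a nonnegative random vector that is multivariate
regularly varying on `ℝ₊² \ {0}` with index `α`, scaling function `b` and limit measure `ν`
homogeneous of order `-α` and concentrated on the wedge
`[wedge] = {x ∈ ℝ₊² : a_l x₁ ≤ x₂ ≤ a_u x₁}` (with `0 < a_l ≤ a_u < ∞`), whose masses of
`(1,∞)×[0,∞)` and `[0,∞)×(1,∞)` are positive and finite, and if
`P(Z₁ > t)/P(Z₂ > t) → 1`, then `a_l ≤ 1 ≤ a_u`. -/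
theorem wedge_must_contain_diagonal
    {Ω : Type*} [MeasureSpace Ω] [IsProbabilityMeasure (ℙ : Measure Ω)]
    (Z₁ Z₂ : Ω → ℝ) (hZ₁ : Measurable Z₁) (hZ₂ : Measurable Z₂)
    (hZnonneg : ∀ ω, 0 ≤ Z₁ ω ∧ 0 ≤ Z₂ ω)
    (α : ℝ) (hα : 0 < α)
    (al au : ℝ) (hal : 0 < al) (halu : al ≤ au)
    (b : ℝ → ℝ) (hbpos : ∀ t > (0:ℝ), 0 < b t)
    (hbcont : ContinuousOn b (Ioi 0)) (hbmono : StrictMonoOn b (Ioi 0))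
    (hbinf : Tendsto b atTop atTop)
    (ν : Measure (ℝ × ℝ))
    -- ν is a (Borel) measure on ℝ₊² : no mass outside [0,∞)²
    (hνsupp : ν {p : ℝ × ℝ | ¬ (0 ≤ p.1 ∧ 0 ≤ p.2)} = 0)
    -- homogeneity: ν(cB) = c^(-α) ν(B)
    (hhom : ∀ c > (0:ℝ), ∀ B : Set (ℝ × ℝ), MeasurableSet B →
      ν ((fun p : ℝ × ℝ => (c * p.1, c * p.2)) '' B) = ENNReal.ofReal (c ^ (-α)) * ν B)
    -- ν concentrates on the wedge: ν(ℝ₊² \ [wedge]) = 0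
    (hwedge : ν {p : ℝ × ℝ | (0 ≤ p.1 ∧ 0 ≤ p.2) ∧
      ¬ (al * p.1 ≤ p.2 ∧ p.2 ≤ au * p.1)} = 0)
    (hpos1 : 0 < ν (Ioi 1 ×ˢ Ici 0)) (hfin1 : ν (Ioi 1 ×ˢ Ici 0) < ⊤)
    (hpos2 : 0 < ν (Ici 0 ×ˢ Ioi 1)) (hfin2 : ν (Ici 0 ×ˢ Ioi 1) < ⊤)
    -- marginal tail convergences of the regular variation
    (hconv1 : ∀ s > (0:ℝ), Tendsto (fun t : ℝ => t * (ℙ {ω | Z₁ ω > b t * s}).toReal)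
      atTop (𝓝 (ν (Ioi s ×ˢ Ici 0)).toReal))
    (hconv2 : ∀ s > (0:ℝ), Tendsto (fun t : ℝ => t * (ℙ {ω | Z₂ ω > b t * s}).toReal)
      atTop (𝓝 (ν (Ici 0 ×ˢ Ioi s)).toReal))
    -- tail equivalence
    (hratio : Tendsto (fun t : ℝ => (ℙ {ω | Z₁ ω > t}).toReal / (ℙ {ω | Z₂ ω > t}).toReal)
      atTop (𝓝 1)) :
    al ≤ 1 ∧ 1 ≤ au := by
  have hm : ν (Ioi 1 ×ˢ Ici 0) = ν (Ici 0 ×ˢ Ioi 1) := by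
    refine (ENNReal.toReal_eq_toReal_iff' hfin1.ne hfin2.ne).1 ?_
    exact tail_limits_eq (F := fun t => (ℙ {ω | Z₁ ω > t}).toReal)
      (G := fun t => (ℙ {ω | Z₂ ω > t}).toReal) hbinf
      (by simpa using hconv1 1 one_pos) (by simpa using hconv2 1 one_pos)
      (ENNReal.toReal_pos hpos2.ne' hfin2.ne).ne' hratio
  have hae : ∀ᵐ p ∂ν, (0 ≤ p.1 ∧ 0 ≤ p.2) → al * p.1 ≤ p.2 ∧ p.2 ≤ au * p.1 := by
    rw [ae_iff]
    simpa only [Classical.not_imp] using hwedge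
  constructor
  · by_contra! h
    refine (ofReal_rpow_neg_mul_lt_self h hα hpos2 hfin2).not_ge ?_
    rw [← hhom al hal _ (measurableSet_Ici.prod measurableSet_Ioi), ← hm]
    refine measure_mono_ae ?_
    filter_upwards [hae] with p hp hpA
    have h1 : 1 < p.1 := hpA.1
    have h2 : 0 ≤ p.2 := hpA.2
    have hw := (hp ⟨by linarith, h2⟩).1
    refine ⟨(p.1 / al, p.2 / al), ⟨div_nonneg (by linarith) hal.le, ?_⟩, ?_⟩
    · exact (one_lt_div hal).2 (by nlinarith)
    · ext <;> simp only [] <;> field_simp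
  · by_contra! h
    have hau : 0 < au := hal.trans_le halu
    refine (ofReal_rpow_neg_mul_lt_self ((one_lt_inv₀ hau).2 h) hα hpos1 hfin1).not_ge ?_
    rw [← hhom _ (inv_pos.2 hau) _ (measurableSet_Ioi.prod measurableSet_Ici), hm]
    refine measure_mono_ae ?_
    filter_upwards [hae] with p hp hpA
    have h1 : 0 ≤ p.1 := hpA.1
    have h2 : 1 < p.2 := hpA.2
    have hw := (hp ⟨h1, by linarith⟩).2
    refine ⟨(au * p.1, au * p.2), ⟨h2.trans_le hw, mul_nonneg hau.le (by linarith)⟩, ?_⟩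
    ext <;> simp only [] <;> field_simp
end

section
/- Let α > 0, let 1 < a_l ≤ a_u < ∞, and let ν be a Borel measure on ℝ₊² such that ν(cB) = c^{-α} ν(B) for all c > 0 and Borel B, ν is concentrated on [wedge] = {x ∈ ℝ₊² : a_l x₁ ≤ x₂ ≤ a_u x₁}, and 0 < ν((1,∞)×[0,∞)) < ∞. Then ν((1,∞)×[0,∞)) < ν([0,∞)×(1,∞)); in particular ν((1,∞)×[0,∞)) ≠ ν([0,∞)×(1,∞)). -/
open MeasureTheory Set

/-- If `ν` is a `-α`-homogeneous Borel measure on `ℝ₊²` concentrated on the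
wedge `{x ∈ ℝ₊² : a_l x₁ ≤ x₂ ≤ a_u x₁}` with `1 < a_l ≤ a_u < ∞` and
`0 < ν((1,∞)×[0,∞)) < ∞`, then `ν((1,∞)×[0,∞)) < ν([0,∞)×(1,∞))`; in particular the two
quantities differ. -/
theorem wedge_above_diagonal_unbalanced
    (α : ℝ) (hα : 0 < α)
    (al au : ℝ) (hal : 1 < al) (halu : al ≤ au)
    (ν : Measure (ℝ × ℝ))
    -- ν is a (Borel) measure on ℝ₊² : no mass outside [0,∞)²
    (hνsupp : ν {p : ℝ × ℝ | ¬ (0 ≤ p.1 ∧ 0 ≤ p.2)} = 0)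
    -- homogeneity: ν(cB) = c^(-α) ν(B)
    (hhom : ∀ c > (0:ℝ), ∀ B : Set (ℝ × ℝ), MeasurableSet B →
      ν ((fun p : ℝ × ℝ => (c * p.1, c * p.2)) '' B) = ENNReal.ofReal (c ^ (-α)) * ν B)
    -- ν concentrates on the wedge: ν(ℝ₊² \ [wedge]) = 0
    (hwedge : ν {p : ℝ × ℝ | (0 ≤ p.1 ∧ 0 ≤ p.2) ∧
      ¬ (al * p.1 ≤ p.2 ∧ p.2 ≤ au * p.1)} = 0)
    (hpos : 0 < ν (Ioi 1 ×ˢ Ici 0)) (hfin : ν (Ioi 1 ×ˢ Ici 0) < ⊤) :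
    ν (Ioi 1 ×ˢ Ici 0) < ν (Ici 0 ×ˢ Ioi 1) ∧
      ν (Ioi 1 ×ˢ Ici 0) ≠ ν (Ici 0 ×ˢ Ioi 1) := by
  have hal0 : 0 < al := one_pos.trans hal
  have hscale : 1 < al⁻¹ ^ (-α) :=
    Real.one_lt_rpow_of_pos_of_lt_one_of_neg (inv_pos.2 hal0) (inv_lt_one_of_one_lt₀ hal)
      (neg_lt_zero.2 hα)
  have hsub : (fun p : ℝ × ℝ => (al⁻¹ * p.1, al⁻¹ * p.2)) '' (Ioi 1 ×ˢ Ici 0) ⊆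
      (Ici 0 ×ˢ Ioi 1) ∪ {p : ℝ × ℝ | (0 ≤ p.1 ∧ 0 ≤ p.2) ∧
        ¬ (al * p.1 ≤ p.2 ∧ p.2 ≤ au * p.1)} := by
    rintro _ ⟨⟨x, y⟩, ⟨hx, hy⟩, rfl⟩
    simp only [mem_Ioi, mem_Ici] at hx hy
    have hx' : 0 ≤ al⁻¹ * x := by positivity
    have hy' : 0 ≤ al⁻¹ * y := by positivity
    by_cases h : al * (al⁻¹ * x) ≤ al⁻¹ * y ∧ al⁻¹ * y ≤ au * (al⁻¹ * x)
    · refine Or.inl ⟨hx', ?_⟩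
      have h₁ := h.1
      rw [mul_inv_cancel_left₀ hal0.ne'] at h₁
      exact hx.trans_le h₁
    · exact Or.inr ⟨⟨hx', hy'⟩, h⟩
  have hlt : ν (Ioi 1 ×ˢ Ici 0) < ν (Ici 0 ×ˢ Ioi 1) := calc
    ν (Ioi 1 ×ˢ Ici 0) = 1 * ν (Ioi 1 ×ˢ Ici 0) := (one_mul _).symm
    _ < ENNReal.ofReal (al⁻¹ ^ (-α)) * ν (Ioi 1 ×ˢ Ici 0) :=
      ENNReal.mul_lt_mul_left hpos.ne' hfin.ne (ENNReal.one_lt_ofReal.2 hscale)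
    _ = ν ((fun p : ℝ × ℝ => (al⁻¹ * p.1, al⁻¹ * p.2)) '' (Ioi 1 ×ˢ Ici 0)) :=
      (hhom _ (inv_pos.2 hal0) _ (measurableSet_Ioi.prod measurableSet_Ici)).symm
    _ ≤ ν (Ici 0 ×ˢ Ioi 1) + 0 := hwedge ▸ (measure_mono hsub).trans (measure_union_le _ _)
    _ = ν (Ici 0 ×ˢ Ioi 1) := add_zero _
  exact ⟨hlt, hlt.ne⟩
end

section
/- Let α > 0, let 0 < a_l ≤ a_u < 1, and let ν be a Borel measure on ℝ₊² such that ν(cB) = c^{-α} ν(B) for all c > 0 and Borel B, ν is concentrated on [wedge] = {x ∈ ℝ₊² : a_l x₁ ≤ x₂ ≤ a_u x₁}, and 0 < ν([0,∞)×(1,∞)) < ∞. Then ν([0,∞)×(1,∞)) < ν((1,∞)×[0,∞)); in particular ν((1,∞)×[0,∞)) ≠ ν([0,∞)×(1,∞)). -/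
open MeasureTheory Set

/-- If `ν` is a `-α`-homogeneous Borel measure on `ℝ₊²` concentrated on the
wedge `{x ∈ ℝ₊² : a_l x₁ ≤ x₂ ≤ a_u x₁}` with `0 < a_l ≤ a_u < 1` and
`0 < ν([0,∞)×(1,∞)) < ∞`, then `ν([0,∞)×(1,∞)) < ν((1,∞)×[0,∞))`; in particular the two
quantities differ. -/
theorem wedge_below_diagonal_unbalanced
    (α : ℝ) (hα : 0 < α)
    (al au : ℝ) (hal : 0 < al) (halu : al ≤ au) (hau : au < 1)
    (ν : Measure (ℝ × ℝ))
    -- ν is a (Borel) measure on ℝ₊² : no mass outside [0,∞)²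
    (hνsupp : ν {p : ℝ × ℝ | ¬ (0 ≤ p.1 ∧ 0 ≤ p.2)} = 0)
    -- homogeneity: ν(cB) = c^(-α) ν(B)
    (hhom : ∀ c > (0:ℝ), ∀ B : Set (ℝ × ℝ), MeasurableSet B →
      ν ((fun p : ℝ × ℝ => (c * p.1, c * p.2)) '' B) = ENNReal.ofReal (c ^ (-α)) * ν B)
    -- ν concentrates on the wedge: ν(ℝ₊² \ [wedge]) = 0
    (hwedge : ν {p : ℝ × ℝ | (0 ≤ p.1 ∧ 0 ≤ p.2) ∧
      ¬ (al * p.1 ≤ p.2 ∧ p.2 ≤ au * p.1)} = 0)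
    (hpos : 0 < ν (Ici 0 ×ˢ Ioi 1)) (hfin : ν (Ici 0 ×ˢ Ioi 1) < ⊤) :
    ν (Ici 0 ×ˢ Ioi 1) < ν (Ioi 1 ×ˢ Ici 0) ∧
      ν (Ioi 1 ×ˢ Ici 0) ≠ ν (Ici 0 ×ˢ Ioi 1) := by
  have hau0 : 0 < au := hal.trans_le halu
  have hmeas : MeasurableSet (Ici (0 : ℝ) ×ˢ Ioi (1 : ℝ)) := measurableSet_Ici.prod measurableSet_Ioi
  have hsub : (fun p : ℝ × ℝ => (au * p.1, au * p.2)) '' (Ici 0 ×ˢ Ioi 1) ⊆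
      (Ioi 1 ×ˢ Ici 0) ∪ {p : ℝ × ℝ | (0 ≤ p.1 ∧ 0 ≤ p.2) ∧
        ¬ (al * p.1 ≤ p.2 ∧ p.2 ≤ au * p.1)} := by
    rintro _ ⟨⟨x, y⟩, ⟨hx, hy⟩, rfl⟩
    simp only [mem_Ici, mem_Ioi] at hx hy
    have hx' : 0 ≤ au * x := by positivity
    have hy' : 0 ≤ au * y := by positivity
    by_cases h : al * (au * x) ≤ au * y ∧ au * y ≤ au * (au * x)
    · exact Or.inl ⟨hy.trans_le (le_of_mul_le_mul_left h.2 hau0), hy'⟩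
    · exact Or.inr ⟨⟨hx', hy'⟩, h⟩
  have hle : ENNReal.ofReal (au ^ (-α)) * ν (Ici 0 ×ˢ Ioi 1) ≤ ν (Ioi 1 ×ˢ Ici 0) := by
    rw [← hhom au hau0 _ hmeas]
    calc _ ≤ _ := measure_mono hsub
      _ ≤ _ := measure_union_le _ _
      _ = _ := by rw [hwedge, add_zero]
  have hscale : 1 < ENNReal.ofReal (au ^ (-α)) := by
    rw [ENNReal.one_lt_ofReal]
    exact Real.one_lt_rpow_of_pos_of_lt_one_of_neg hau0 hau (neg_neg_of_pos hα)
  have hlt : ν (Ici 0 ×ˢ Ioi 1) < ν (Ioi 1 ×ˢ Ici 0) := by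
    refine lt_of_lt_of_le ?_ hle
    simpa using ENNReal.mul_lt_mul_left hpos.ne' hfin.ne hscale
  exact ⟨hlt, hlt.ne'⟩
end

section
/- Let Z = (Z₁, Z₂) be a random vector with values in ℝ₊², let 0 < a_l ≤ a_u < ∞, let α₀ > 0, let c_u, c_l ∈ [0,∞), and let b, b₀ : (0,∞) → (0,∞) with b(t)/b₀(t) → ∞. Suppose: (i) for every x > 0, t·P(Z₂ − a_u Z₁ > b₀(t)x) → c_u x^{-α₀} and t·P(a_l Z₁ − Z₂ > b₀(t)x) → c_l x^{-α₀} as t → ∞; (ii) ν is a Borel measure on ℝ₊² such that for every δ > 0, t·P(Z₂ − a_u Z₁ > b(t)δ) → ν({x ∈ ℝ₊² : x₂ − a_u x₁ > δ}) and t·P(a_l Z₁ − Z₂ > b(t)δ) → ν({x ∈ ℝ₊² : a_l x₁ − x₂ > δ}). Then ν(ℝ₊² \ [wedge]) = 0, i.e. the limit measure ν concentrates on [wedge] = {x ∈ ℝ₊² : a_l x₁ ≤ x₂ ≤ a_u x₁}. -/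
open MeasureTheory ProbabilityTheory Filter Set Topology

/-- If the tails of `W` at scale `b₀` have limits `c * x ^ (-α)` with `α > 0`, then every limit of
the tails at a scale `b` of larger order than `b₀` vanishes. -/
theorem tail_limit_eq_zero_of_scaling_ratio_atTop
    {Ω : Type*} [MeasurableSpace Ω] {P : Measure Ω} {W : Ω → ℝ} {b b₀ : ℝ → ℝ} {α c : ℝ}
    (hα : 0 < α) (hb₀ : ∀ t > (0 : ℝ), 0 < b₀ t)
    (hratio : Tendsto (fun t : ℝ => b t / b₀ t) atTop atTop)
    (htail : ∀ x > (0 : ℝ), Tendsto (fun t : ℝ => ENNReal.ofReal t * P {ω | W ω > b₀ t * x})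
      atTop (𝓝 (ENNReal.ofReal (c * x ^ (-α)))))
    {δ : ℝ} (hδ : 0 < δ) {L : ENNReal}
    (hL : Tendsto (fun t : ℝ => ENNReal.ofReal t * P {ω | W ω > b t * δ}) atTop (𝓝 L)) :
    L = 0 := by
  have hbound : ∀ x > (0 : ℝ), L ≤ ENNReal.ofReal (c * x ^ (-α)) := by
    intro x hx
    refine le_of_tendsto_of_tendsto hL (htail x hx) ?_
    filter_upwards [hratio.eventually_ge_atTop (x / δ), eventually_gt_atTop 0] with t ht ht₀
    refine mul_le_mul_right (measure_mono fun ω hω => ?_) _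
    rw [div_le_div_iff₀ hδ (hb₀ t ht₀)] at ht
    exact (mul_comm (b₀ t) x ▸ ht).trans_lt (mem_setOf.1 hω)
  have hlim : Tendsto (fun x : ℝ => ENNReal.ofReal (c * x ^ (-α))) atTop (𝓝 0) := by
    simpa using ENNReal.tendsto_ofReal ((tendsto_rpow_neg_atTop hα).const_mul c)
  refine le_antisymm (ge_of_tendsto hlim ?_) zero_le
  filter_upwards [eventually_gt_atTop 0] with x hx using hbound x hx

/-- A measure that gives no mass to `{p ∈ A | δ < f p}` for any `δ > 0` gives no mass to
`{p ∈ A | 0 < f p}`. -/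
theorem measure_pos_eq_zero_of_forall_measure_gt_eq_zero
    {E : Type*} [MeasurableSpace E] {μ : Measure E} {A : E → Prop} {f : E → ℝ}
    (h : ∀ δ > (0 : ℝ), μ {p | A p ∧ f p > δ} = 0) : μ {p | A p ∧ 0 < f p} = 0 := by
  refine measure_mono_null (t := ⋃ n : ℕ, {p | A p ∧ f p > 1 / ((n : ℝ) + 1)}) ?_
    (measure_iUnion_null fun n => h _ Nat.one_div_pos_of_nat)
  rintro p ⟨hA, hp⟩
  obtain ⟨n, hn⟩ := exists_nat_one_div_lt hp
  exact mem_iUnion.2 ⟨n, hA, hn⟩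

/-- If the nonnegative random vector `Z = (Z₁,Z₂)` has hidden regular
variation off the wedge (index `α₀`, scaling `b₀`), i.e. for every `x > 0`
`t·P(Z₂ − a_u Z₁ > b₀(t)x) → c_u x^{-α₀}` and `t·P(a_l Z₁ − Z₂ > b₀(t)x) → c_l x^{-α₀}`,
and if the first-level limit measure `ν` (with the larger scaling `b`, `b(t)/b₀(t) → ∞`)
satisfies `t·P(Z₂ − a_u Z₁ > b(t)δ) → ν{x ∈ ℝ₊² : x₂ − a_u x₁ > δ}` and
`t·P(a_l Z₁ − Z₂ > b(t)δ) → ν{x ∈ ℝ₊² : a_l x₁ − x₂ > δ}`, then `ν` concentrates on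
the wedge: `ν(ℝ₊² \ [wedge]) = 0`. -/
theorem limit_measure_concentrates_on_wedge
    {Ω : Type*} [MeasureSpace Ω] [IsProbabilityMeasure (ℙ : Measure Ω)]
    (Z₁ Z₂ : Ω → ℝ) (hZ₁ : Measurable Z₁) (hZ₂ : Measurable Z₂)
    (hZnonneg : ∀ ω, 0 ≤ Z₁ ω ∧ 0 ≤ Z₂ ω)
    (al au : ℝ) (hal : 0 < al) (halu : al ≤ au)
    (α₀ : ℝ) (hα₀ : 0 < α₀) (cu cl : ℝ) (hcu : 0 ≤ cu) (hcl : 0 ≤ cl)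
    (b b₀ : ℝ → ℝ) (hbpos : ∀ t > (0:ℝ), 0 < b t) (hb₀pos : ∀ t > (0:ℝ), 0 < b₀ t)
    (hratio : Tendsto (fun t : ℝ => b t / b₀ t) atTop atTop)
    -- (i) hidden regular variation above and below the wedge, with scaling b₀
    (hhrv_u : ∀ x > (0:ℝ),
      Tendsto (fun t : ℝ => ENNReal.ofReal t * ℙ {ω | Z₂ ω - au * Z₁ ω > b₀ t * x})
        atTop (𝓝 (ENNReal.ofReal (cu * x ^ (-α₀)))))
    (hhrv_l : ∀ x > (0:ℝ),
      Tendsto (fun t : ℝ => ENNReal.ofReal t * ℙ {ω | al * Z₁ ω - Z₂ ω > b₀ t * x})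
        atTop (𝓝 (ENNReal.ofReal (cl * x ^ (-α₀)))))
    (ν : Measure (ℝ × ℝ))
    -- (ii) first-level convergence to ν on the regions above and below the wedge,
    -- with scaling b
    (hmrv_u : ∀ δ > (0:ℝ),
      Tendsto (fun t : ℝ => ENNReal.ofReal t * ℙ {ω | Z₂ ω - au * Z₁ ω > b t * δ})
        atTop (𝓝 (ν {p : ℝ × ℝ | (0 ≤ p.1 ∧ 0 ≤ p.2) ∧ p.2 - au * p.1 > δ})))
    (hmrv_l : ∀ δ > (0:ℝ),
      Tendsto (fun t : ℝ => ENNReal.ofReal t * ℙ {ω | al * Z₁ ω - Z₂ ω > b t * δ})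
        atTop (𝓝 (ν {p : ℝ × ℝ | (0 ≤ p.1 ∧ 0 ≤ p.2) ∧ al * p.1 - p.2 > δ}))) :
    ν {p : ℝ × ℝ | (0 ≤ p.1 ∧ 0 ≤ p.2) ∧ ¬ (al * p.1 ≤ p.2 ∧ p.2 ≤ au * p.1)} = 0 := by
  have hu := measure_pos_eq_zero_of_forall_measure_gt_eq_zero fun δ hδ =>
    tail_limit_eq_zero_of_scaling_ratio_atTop hα₀ hb₀pos hratio hhrv_u hδ (hmrv_u δ hδ)
  have hl := measure_pos_eq_zero_of_forall_measure_gt_eq_zero fun δ hδ =>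
    tail_limit_eq_zero_of_scaling_ratio_atTop hα₀ hb₀pos hratio hhrv_l hδ (hmrv_l δ hδ)
  refine measure_mono_null ?_ (measure_union_null hu hl)
  rintro p ⟨hp, hw⟩
  rw [not_and_or, not_le, not_le] at hw
  rcases hw with hw | hw
  · exact Or.inr ⟨hp, sub_pos.2 hw⟩
  · exact Or.inl ⟨hp, sub_pos.2 hw⟩
end

section
/- Equip ℝ² with the Euclidean (L²) distance, let 0 < a_l ≤ a_u < ∞ and let W = {x ∈ ℝ₊² : a_l x₁ ≤ x₂ ≤ a_u x₁} be the wedge. Then the set of points of ℝ₊² at distance exactly 1 from W is {x ∈ ℝ₊² : dist(x, W) = 1} = {(u, a_u u + √(1 + a_u²)) : u ≥ 0} ∪ {(u, a_l u − √(1 + a_l²)) : u ≥ √(1 + a_l²)/a_l}. -/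
open Metric Set

open Real in
/-- If `S` contains the ray `{(t, a t) : t ≥ 0}` and lies on one side of the line `y = a x`
(which one is encoded by the sign `s`), then the distance to `S` of a point on the other side
whose orthogonal projection to the line lies on the ray is its distance to the line. -/
theorem infDist_eq_of_ray_subset_of_halfPlane {a s : ℝ} (hs : s ^ 2 = 1)
    {S : Set (EuclideanSpace ℝ (Fin 2))} (hray : ∀ t : ℝ, 0 ≤ t → !₂[t, a * t] ∈ S)
    (hhalf : ∀ p ∈ S, s * (p 1 - a * p 0) ≤ 0) {x : EuclideanSpace ℝ (Fin 2)}
    (hx : 0 ≤ s * (x 1 - a * x 0)) (hproj : 0 ≤ x 0 + a * x 1) :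
    infDist x S = s * (x 1 - a * x 0) / √(1 + a ^ 2) := by
  have ha : 0 < 1 + a ^ 2 := by positivity
  apply le_antisymm
  · refine (infDist_le_dist_of_mem (hray _ (div_nonneg hproj ha.le))).trans_eq ?_
    rw [EuclideanSpace.dist_eq, sqrt_eq_iff_mul_self_eq (by positivity) (by positivity),
      div_mul_div_comm, mul_self_sqrt ha.le]
    simp only [Fin.sum_univ_two, Real.dist_eq, sq_abs, Matrix.cons_val_zero,
      Matrix.cons_val_one]
    field_simp
    linear_combination -(x 1 - a * x 0) ^ 2 * (1 + a ^ 2) * hs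
  · refine (le_infDist ⟨_, hray 0 le_rfl⟩).2 fun p hp => ?_
    rw [EuclideanSpace.dist_eq, div_le_iff₀ (sqrt_pos.2 ha), ← sqrt_mul (by positivity)]
    apply le_sqrt_of_sq_le
    simp only [Fin.sum_univ_two, Real.dist_eq, sq_abs]
    have h := hhalf p hp
    have hle : (s * (x 1 - a * x 0)) ^ 2 ≤ (s * (x 1 - a * x 0) - s * (p 1 - a * p 0)) ^ 2 :=
      pow_le_pow_left₀ hx (by linarith) 2
    have hexp : (s * (x 1 - a * x 0) - s * (p 1 - a * p 0)) ^ 2 =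
        ((x 1 - p 1) - a * (x 0 - p 0)) ^ 2 := by
      linear_combination ((x 1 - p 1) - a * (x 0 - p 0)) ^ 2 * hs
    nlinarith [sq_nonneg ((x 0 - p 0) + a * (x 1 - p 1))]

/-- In `ℝ²` with the Euclidean distance, for `0 < a_l ≤ a_u < ∞` and the
wedge `W = {x ∈ ℝ₊² : a_l x₁ ≤ x₂ ≤ a_u x₁}`, the set of points of `ℝ₊²` at distance
exactly `1` from `W` is
`{(u, a_u u + √(1+a_u²)) : u ≥ 0} ∪ {(u, a_l u − √(1+a_l²)) : u ≥ √(1+a_l²)/a_l}`. -/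
theorem unit_sphere_of_wedge
    (al au : ℝ) (hal : 0 < al) (halu : al ≤ au)
    (W : Set (EuclideanSpace ℝ (Fin 2)))
    (hW : W = {p : EuclideanSpace ℝ (Fin 2) |
      0 ≤ p 0 ∧ 0 ≤ p 1 ∧ al * p 0 ≤ p 1 ∧ p 1 ≤ au * p 0}) :
    {x : EuclideanSpace ℝ (Fin 2) | (0 ≤ x 0 ∧ 0 ≤ x 1) ∧ Metric.infDist x W = 1} =
      {x : EuclideanSpace ℝ (Fin 2) |
        ∃ u : ℝ, 0 ≤ u ∧ x 0 = u ∧ x 1 = au * u + Real.sqrt (1 + au ^ 2)} ∪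
      {x : EuclideanSpace ℝ (Fin 2) |
        ∃ u : ℝ, Real.sqrt (1 + al ^ 2) / al ≤ u ∧ x 0 = u ∧
          x 1 = al * u - Real.sqrt (1 + al ^ 2)} := by
  have hau : 0 < au := hal.trans_le halu
  have hWray : ∀ a, al ≤ a → a ≤ au → ∀ t : ℝ, 0 ≤ t → !₂[t, a * t] ∈ W := by
    intro a hla hau' t ht
    rw [hW]
    exact ⟨ht, mul_nonneg (hal.le.trans hla) ht, mul_le_mul_of_nonneg_right hla ht,
      mul_le_mul_of_nonneg_right hau' ht⟩
  have upper : ∀ x : EuclideanSpace ℝ (Fin 2), 0 ≤ x 0 → au * x 0 ≤ x 1 →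
      infDist x W = (x 1 - au * x 0) / Real.sqrt (1 + au ^ 2) := by
    intro x h0 h
    have h1 : 0 ≤ x 1 := (mul_nonneg hau.le h0).trans h
    rw [infDist_eq_of_ray_subset_of_halfPlane (a := au) (s := 1) (by norm_num)
      (hWray au halu le_rfl) ?_ (by linarith) (by positivity), one_mul]
    intro p hp
    rw [hW] at hp
    linarith [hp.2.2.2]
  have lower : ∀ x : EuclideanSpace ℝ (Fin 2), 0 ≤ x 0 → 0 ≤ x 1 → x 1 ≤ al * x 0 →
      infDist x W = (al * x 0 - x 1) / Real.sqrt (1 + al ^ 2) := by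
    intro x h0 h1 h
    rw [infDist_eq_of_ray_subset_of_halfPlane (a := al) (s := -1) (by norm_num)
      (hWray al le_rfl halu) ?_ (by linarith) (by positivity), neg_one_mul, neg_sub]
    intro p hp
    rw [hW] at hp
    linarith [hp.2.2.1]
  have hsu : 0 < Real.sqrt (1 + au ^ 2) := by positivity
  have hsl : 0 < Real.sqrt (1 + al ^ 2) := by positivity
  ext x
  constructor
  · rintro ⟨⟨h0, h1⟩, hd⟩
    rcases le_total (au * x 0) (x 1) with hu | hu
    · rw [upper x h0 hu, div_eq_one_iff_eq hsu.ne'] at hd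
      exact Or.inl ⟨x 0, h0, rfl, by linarith⟩
    rcases le_total (x 1) (al * x 0) with hl | hl
    · rw [lower x h0 h1 hl, div_eq_one_iff_eq hsl.ne'] at hd
      exact Or.inr ⟨x 0, (div_le_iff₀' hal).2 (by linarith), rfl, by linarith⟩
    · have hxW : x ∈ W := by
        rw [hW]
        exact ⟨h0, h1, hl, hu⟩
      rw [infDist_zero_of_mem hxW] at hd
      exact absurd hd zero_ne_one
  · rintro (⟨_, h0, rfl, hx⟩ | ⟨_, hle, rfl, hx⟩)
    · have hu : au * x 0 ≤ x 1 := by linarith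
      refine ⟨⟨h0, (mul_nonneg hau.le h0).trans hu⟩, ?_⟩
      rw [upper x h0 hu, div_eq_one_iff_eq hsu.ne']
      linarith
    · have h0 : 0 ≤ x 0 := (div_pos hsl hal).le.trans hle
      have h1 : 0 ≤ x 1 := by linarith [(div_le_iff₀' hal).1 hle]
      refine ⟨⟨h0, h1⟩, ?_⟩
      rw [lower x h0 h1 (by linarith), div_eq_one_iff_eq hsl.ne']
      linarith
end
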